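/- Let n ≥ 3 and δ ∈ (0,(n−1)/(n+1)). For every μ ∈ Δ^n_+ with μ_(1) = 1−δ, the entropy increase under the split-merge prerule satisfies S(Ř(μ)) − S(μ) ≥ [1 − δ·(n+1)/(n−1)]·log 2 > 0, where S(x) = −Σ_{i=1}^n x_i log x_i. -/

import Mathlib

open scoped BigOperators

/-- The open unit simplex `Δ⁺ₙ`. -/
def simplexPos (n : ℕ) : Set (Fin n → ℝ) := {μ | (∀ i, 0 < μ i) ∧ ∑ i, μ i = 1}

/-- The permutation `p` ranking the components of `μ` in decreasing order,
ties broken in increasing order of index (stable sort of `-μ`). -/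
noncomputable def rankPerm {n : ℕ} (μ : Fin n → ℝ) : Equiv.Perm (Fin n) :=
  Tuple.sort (fun i => -μ i)

/-- The `k`-th reverse order statistic `μ₍ₖ₊₁₎` (0-indexed): `ordStat μ 0` is the
largest component, `ordStat μ (n-1)` the smallest. -/
noncomputable def ordStat {n : ℕ} (μ : Fin n → ℝ) (k : Fin n) : ℝ :=
  μ (rankPerm μ k)

/-- The split-merge prerule `Ř` with diversity parameter `δ`: if `μ₍₁₎ ≥ 1-δ`, the largest
company (rank 1) is split in half, the new half being placed at the index of rank `n-1`,
whose previous two smallest values (ranks `n-1`, `n`) merge into the index of rank `n`;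
otherwise (and when `n < 3`) it is the identity. -/
noncomputable def preRule {n : ℕ} (δ : ℝ) (μ : Fin n → ℝ) : Fin n → ℝ :=
  if hn : 3 ≤ n then
    if ordStat μ ⟨0, by omega⟩ < 1 - δ then μ
    else fun i =>
      if ((rankPerm μ).symm i : ℕ) = 0 then ordStat μ ⟨0, by omega⟩ / 2
      else if ((rankPerm μ).symm i : ℕ) = n - 2 then ordStat μ ⟨0, by omega⟩ / 2
      else if ((rankPerm μ).symm i : ℕ) = n - 1 then
        ordStat μ ⟨n - 1, by omega⟩ + ordStat μ ⟨n - 2, by omega⟩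
      else μ i
  else μ

/-- The entropy function `S(x) = -∑ xᵢ log xᵢ`. -/
noncomputable def entS {n : ℕ} (x : Fin n → ℝ) : ℝ := -∑ i, x i * Real.log (x i)

/-- Splitting off the first and the last two terms of a finite sum. -/
lemma sum_univ_fin_add_three {m : ℕ} (g : Fin (m + 3) → ℝ) :
    ∑ k, g k = g ⟨0, by omega⟩ + ∑ j : Fin m, g ⟨j + 1, by omega⟩
      + g ⟨m + 1, by omega⟩ + g ⟨m + 2, by omega⟩ := by
  rw [Fin.sum_univ_castSucc, Fin.sum_univ_castSucc, Fin.sum_univ_succ]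
  rfl

lemma ordStat_antitone {n : ℕ} (μ : Fin n → ℝ) : Antitone (ordStat μ) := fun _ _ h =>
  neg_le_neg_iff.mp (Tuple.monotone_sort (fun i => -μ i) h)

lemma sum_ordStat {n : ℕ} (μ : Fin n → ℝ) : ∑ k, ordStat μ k = ∑ i, μ i :=
  Equiv.sum_comp (rankPerm μ) μ

/-- The entropy may be summed along the ranking of `μ`. -/
lemma entS_comp_rankPerm {n : ℕ} (μ x : Fin n → ℝ) :
    entS x = -∑ k, x (rankPerm μ k) * Real.log (x (rankPerm μ k)) := by
  rw [entS, Equiv.sum_comp (rankPerm μ) (fun i => x i * Real.log (x i))]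

/-- Merging two positive masses loses at most `log 2` times their sum in entropy. -/
lemma add_mul_log_add_le {b c : ℝ} (hb : 0 < b) (hc : 0 < c) :
    (b + c) * Real.log (b + c) ≤
      b * Real.log b + c * Real.log c + (b + c) * Real.log 2 := by
  have h := Real.convexOn_mul_log.2 (Set.mem_Ici.mpr hb.le) (Set.mem_Ici.mpr hc.le)
    (by norm_num : (0 : ℝ) ≤ 1 / 2) (by norm_num : (0 : ℝ) ≤ 1 / 2) (by norm_num)
  simp only [smul_eq_mul] at h
  rw [show 1 / 2 * b + 1 / 2 * c = (b + c) / 2 by ring,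
    Real.log_div (by positivity) two_ne_zero] at h
  linarith

/-- Splitting the largest component and merging the two smallest ones only changes
the corresponding terms of the entropy. -/
lemma entS_preRule_sub {m : ℕ} {δ : ℝ} (μ : Fin (m + 3) → ℝ)
    (htop : 1 - δ ≤ ordStat μ ⟨0, by omega⟩) (hpos : 0 < ordStat μ ⟨0, by omega⟩) :
    entS (preRule δ μ) - entS μ =
      ordStat μ ⟨0, by omega⟩ * Real.log 2
      + ordStat μ ⟨m + 1, by omega⟩ * Real.log (ordStat μ ⟨m + 1, by omega⟩)
      + ordStat μ ⟨m + 2, by omega⟩ * Real.log (ordStat μ ⟨m + 2, by omega⟩)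
      - (ordStat μ ⟨m + 1, by omega⟩ + ordStat μ ⟨m + 2, by omega⟩)
        * Real.log (ordStat μ ⟨m + 1, by omega⟩ + ordStat μ ⟨m + 2, by omega⟩) := by
  have hR (k : Fin (m + 3)) : preRule δ μ (rankPerm μ k) =
      if (k : ℕ) = 0 then ordStat μ ⟨0, by omega⟩ / 2
      else if (k : ℕ) = m + 1 then ordStat μ ⟨0, by omega⟩ / 2
      else if (k : ℕ) = m + 2 then
        ordStat μ ⟨m + 2, by omega⟩ + ordStat μ ⟨m + 1, by omega⟩
      else ordStat μ k := by
    rw [preRule, dif_pos (by omega), if_neg (not_lt.mpr htop)]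
    simp only [Equiv.symm_apply_apply]
    rfl
  rw [entS_comp_rankPerm μ (preRule δ μ), entS_comp_rankPerm μ μ]
  simp only [hR]
  rw [sum_univ_fin_add_three, sum_univ_fin_add_three]
  have hmid (j : Fin m) : (j : ℕ) ≠ m ∧ (j : ℕ) ≠ m + 1 := by omega
  simp only [← ordStat.eq_def, hmid, Nat.add_eq_zero_iff, one_ne_zero, OfNat.ofNat_ne_zero,
    and_false, if_true, if_false, Nat.add_right_cancel_iff,
    show ∀ j : ℕ, (j + 1 = m + 2) = (j = m + 1) by intro j; simp,
    show m + 2 ≠ m + 1 by omega]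
  rw [Real.log_div hpos.ne' two_ne_zero, add_comm (ordStat μ ⟨m + 2, _⟩)]
  ring

/-- The two smallest components have at most their proportional share of the mass
left over by the largest one. -/
lemma add_ordStat_last_le {m : ℕ} (μ : Fin (m + 3) → ℝ) :
    (m + 2) * (ordStat μ ⟨m + 1, by omega⟩ + ordStat μ ⟨m + 2, by omega⟩) ≤
      2 * (∑ i, μ i - ordStat μ ⟨0, by omega⟩) := by
  have hmid : (m : ℝ) * ordStat μ ⟨m + 1, by omega⟩ ≤
      ∑ j : Fin m, ordStat μ ⟨j + 1, by omega⟩ := by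
    simpa using Finset.card_nsmul_le_sum Finset.univ
      (fun j : Fin m => ordStat μ ⟨j + 1, by omega⟩) _
      (fun j _ => ordStat_antitone μ (Fin.mk_le_mk.mpr (by omega)))
  have hlast : ordStat μ ⟨m + 2, by omega⟩ ≤ ordStat μ ⟨m + 1, by omega⟩ :=
    ordStat_antitone μ (Fin.mk_le_mk.mpr (by omega))
  have hm := mul_le_mul_of_nonneg_left hlast (Nat.cast_nonneg (α := ℝ) m)
  rw [← sum_ordStat, sum_univ_fin_add_three]
  linarith

/-- For `n ≥ 3` and `δ ∈ (0,(n-1)/(n+1))`, the entropy increase at a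
split-merge prerule event satisfies `S(Ř(μ)) - S(μ) ≥ (1 - δ(n+1)/(n-1))·log 2 > 0`. -/
theorem entropy_increase_preRule
    (n : ℕ) (hn : 3 ≤ n) (δ : ℝ)
    (hδ : δ ∈ Set.Ioo (0 : ℝ) (((n : ℝ) - 1) / ((n : ℝ) + 1)))
    (μ : Fin n → ℝ) (hμ : μ ∈ simplexPos n)
    (htop : ordStat μ ⟨0, by omega⟩ = 1 - δ) :
    (1 - δ * ((n : ℝ) + 1) / ((n : ℝ) - 1)) * Real.log 2 ≤ entS (preRule δ μ) - entS μ ∧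
      0 < (1 - δ * ((n : ℝ) + 1) / ((n : ℝ) - 1)) * Real.log 2 := by
  obtain ⟨m, rfl⟩ := Nat.exists_eq_add_of_le' hn
  obtain ⟨hpos, hsum⟩ := hμ
  have hm : (0 : ℝ) < m + 2 := by positivity
  have hlog := Real.log_pos one_lt_two
  have hδ' := hδ.2
  push_cast at hδ' ⊢
  rw [show (m : ℝ) + 3 - 1 = m + 2 by ring] at hδ' ⊢
  have hshare : δ * (m + 3 + 1) < m + 2 := (lt_div_iff₀ (by positivity)).mp hδ'
  refine ⟨?_, mul_pos (sub_pos.mpr ((div_lt_one hm).mpr hshare)) hlog⟩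
  rw [entS_preRule_sub μ htop.ge (hpos _)]
  have hbc := add_ordStat_last_le μ
  have hmerge := add_mul_log_add_le (hpos (rankPerm μ ⟨m + 1, by omega⟩))
    (hpos (rankPerm μ ⟨m + 2, by omega⟩))
  simp only [← ordStat.eq_def] at hmerge
  rw [htop, hsum] at hbc
  rw [htop]
  set b := ordStat μ ⟨m + 1, by omega⟩
  set c := ordStat μ ⟨m + 2, by omega⟩
  have hcoef : 1 - δ * (m + 3 + 1) / (m + 2) ≤ 1 - δ - (b + c) := by
    have hle : b + c ≤ 2 * δ / (m + 2) := by
      rw [le_div_iff₀ hm]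
      linarith
    have heq : δ * (m + 3 + 1) / (m + 2) = δ + 2 * δ / (m + 2) := by
      field_simp
      ring
    linarith
  have := mul_le_mul_of_nonneg_right hcoef hlog.le
  linarith
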